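/- Let a, b be distinct letters of α, let n > 1, and let τ = a^n · b · a · b^n (so |τ| = 2n+2). Let P ∈ FreeMonoid (α ⊕ Unit) be a unary polynomial with exactly k occurrences of the variable Sum.inr (), suppose P is τ-irreducible (the word τ, with its letters embedded via Sum.inl, is not a factor of P), and suppose |τ| ≥ 2k + 4. If τ is a factor of P(ε) (P evaluated at the empty word), then there exists θ ∈ {a, b} and a factor w of P(θ) such that |w| > |τ|, τ is not a factor of w, and τ and w do not overlap, i.e. there do not exist words u, t', t with t nonempty and t ≠ τ such that either (w = u·t and τ = t·t') or (τ = t'·t and w = t·u). -/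

import Mathlib

/-- `w` is a factor of `t`. -/
def IsFactor {α : Type*} (w t : FreeMonoid α) : Prop := ∃ u u' : FreeMonoid α, t = u * w * u'

/-- Evaluation of a unary word polynomial `P` at the word `u`. -/
def polyEval {α : Type*} (P : FreeMonoid (α ⊕ Unit)) (u : FreeMonoid α) : FreeMonoid α :=
  FreeMonoid.lift (Sum.elim FreeMonoid.of (fun _ => u)) P

/-- The word `aⁿbabⁿ`, as a list. -/
def tauWord {α : Type*} (a b : α) (n : ℕ) : List α :=
  List.replicate n a ++ [b, a] ++ List.replicate n b

/-- Replace every variable of the polynomial by the letter `θ`. -/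
def fillVar {α : Type*} (θ : α) (Q : List (α ⊕ Unit)) : List α :=
  Q.map (Sum.elim id fun _ => θ)

/-- `w` is longer than `s`, avoids `s` as a factor and does not overlap with `s`. -/
structure StronglyAvoids {α : Type*} (s w : List α) : Prop where
  length_lt : s.length < w.length
  not_infix : ¬ s <:+: w
  no_suffix_overlap : ∀ t, t ≠ [] → t ≠ s → t <:+ w → ¬ t <+: s
  no_prefix_overlap : ∀ t, t ≠ [] → t ≠ s → t <+: w → ¬ t <:+ s

section Lists

variable {α : Type*} {a b : α} {n : ℕ}

theorem StronglyAvoids.of_reverse {s w : List α} (h : StronglyAvoids s.reverse w.reverse) :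
    StronglyAvoids s w where
  length_lt := by simpa using h.length_lt
  not_infix := fun hi => h.not_infix (List.reverse_infix.2 hi)
  no_suffix_overlap := fun t h0 h1 h2 h3 => h.no_prefix_overlap t.reverse (by simpa using h0)
    (by simpa using h1) (List.reverse_prefix.2 h2) (List.reverse_suffix.2 h3)
  no_prefix_overlap := fun t h0 h1 h2 h3 => h.no_suffix_overlap t.reverse (by simpa using h0)
    (by simpa using h1) (List.reverse_suffix.2 h2) (List.reverse_prefix.2 h3)

theorem reverse_tauWord : (tauWord a b n).reverse = tauWord b a n := by
  simp [tauWord]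

theorem length_tauWord : (tauWord a b n).length = 2 * n + 2 := by
  simp [tauWord]; omega

theorem fillVar_append (θ : α) (Q R : List (α ⊕ Unit)) :
    fillVar θ (Q ++ R) = fillVar θ Q ++ fillVar θ R := List.map_append

theorem length_eq_filterMap_add_countP (Q : List (α ⊕ Unit)) :
    Q.length = (Q.filterMap Sum.getLeft?).length + Q.countP Sum.isRight := by
  induction Q with
  | nil => rfl
  | cons x Q ih => rcases x with c | _ <;> simp [ih, List.filterMap_cons, List.countP_cons] <;> omega

theorem count_fillVar_self [DecidableEq α] (Q : List (α ⊕ Unit)) :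
    (fillVar b Q).count b = (Q.filterMap Sum.getLeft?).count b + Q.countP Sum.isRight := by
  unfold fillVar
  induction Q with
  | nil => rfl
  | cons x Q ih => rcases x with c | _ <;> simp [ih, List.count_cons, List.filterMap_cons, List.countP_cons] <;> omega

theorem count_fillVar_of_ne [DecidableEq α] (hab : a ≠ b) (Q : List (α ⊕ Unit)) :
    (fillVar b Q).count a = (Q.filterMap Sum.getLeft?).count a := by
  unfold fillVar
  induction Q with
  | nil => rfl
  | cons x Q ih => rcases x with c | _ <;> simp [ih, List.count_cons, List.filterMap_cons, hab.symm]

theorem mem_fillVar {c : α} {Q : List (α ⊕ Unit)} (h : c ∈ fillVar b Q) :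
    c = b ∨ c ∈ Q.filterMap Sum.getLeft? := by
  obtain ⟨x, hx, rfl⟩ := List.mem_map.1 h
  rcases x with c | _
  · exact Or.inr (List.mem_filterMap.2 ⟨_, hx, rfl⟩)
  · exact Or.inl rfl

/-- If no variable occurs, the polynomial is the word obtained by erasing variables. -/
theorem eq_map_inl_filterMap {Q : List (α ⊕ Unit)} (h : Q.countP Sum.isRight = 0) :
    Q = (Q.filterMap Sum.getLeft?).map Sum.inl := by
  induction Q with
  | nil => rfl
  | cons x Q ih =>
    rcases x with c | _
    · simp only [List.countP_cons, Sum.isRight_inl] at h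
      simpa using ih (by simpa using h)
    · simp at h

/-- The words `W a bᵐ`, where `W` starts with `a`, ends with `b`, contains `n` occurrences of `a`
and between `2` and `n` occurrences of `b`, strongly avoid `aⁿbabⁿ`. -/
theorem stronglyAvoids_append_cons_replicate [DecidableEq α] (hab : a ≠ b) (hn : 1 < n)
    {m : ℕ} (hm : n ≤ m) {W : List α} (hhead : W.head? = some a) (hlast : W.getLast? = some b)
    (hlen : n + 2 ≤ W.length) (ha : W.count a = n) (hb : 2 ≤ W.count b) (hb' : W.count b ≤ n) :
    StronglyAvoids (tauWord a b n) (W ++ a :: List.replicate m b) := by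
  obtain ⟨W₁, rfl⟩ : ∃ W₁, W = a :: W₁ := by
    cases W with
    | nil => simp at hhead
    | cons c W => simp at hhead; exact ⟨W, by rw [hhead]⟩
  obtain ⟨m, rfl⟩ : ∃ m', m = m' + 2 := ⟨m - 2, by omega⟩
  obtain ⟨n, rfl⟩ : ∃ n', n = n' + 2 := ⟨n - 2, by omega⟩
  set W := a :: W₁ with hW
  set w := W ++ a :: List.replicate (m + 2) b with hw
  have hba : b ≠ a := hab.symm
  have hcw : w.count a = n + 3 := by
    simp [hw, ha, List.count_replicate, hba]
  have hwl : (tauWord a b (n + 2)).length < w.length := by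
    rw [length_tauWord]; simp only [hw, List.length_append, List.length_cons,
      List.length_replicate]; omega
  have full (u t : List α) (h : w = u ++ t) (ht : t.count a = n + 3) : u = [] := by
    have : u.count a = 0 := by
      have := congrArg (List.count a) h
      rw [hcw, List.count_append] at this; omega
    cases u with
    | nil => rfl
    | cons c u => simp [hw, hW] at h; simp [← h.1] at this
  refine ⟨hwl, ?_, ?_, ?_⟩
  · rintro ⟨u, u', h⟩
    have hu : u = [] := by
      refine full u (tauWord a b (n + 2) ++ u') (by simp [← h]) ?_
      have := congrArg (List.count a) h
      rw [hcw] at this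
      simp [tauWord, List.count_replicate, hba] at this ⊢
      omega
    subst hu
    rw [hw] at h
    have h' : (List.replicate (n + 2) a ++ [b]) ++ (a :: (List.replicate (n + 2) b ++ u')) =
        W ++ a :: List.replicate (m + 2) b := by simpa [tauWord] using h
    rcases List.append_eq_append_iff.1 h' with ⟨s, h1, h2⟩ | ⟨s, h1, h2⟩
    · cases s with
      | nil => rw [h1] at hb; simp [List.count_replicate, hab] at hb
      | cons c s =>
        simp at h2
        rw [h1] at ha
        simp [← h2.1, hba] at ha
    · have := congrArg (List.count b) h1
      simp [List.count_replicate, hab] at this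
      omega
  · rintro t h0 h1 ⟨u, hu⟩ ⟨t', ht'⟩
    have hlastt : t.getLast? = some b := by
      obtain ⟨x, c, rfl⟩ := List.eq_nil_or_concat t |>.resolve_left h0
      have hx : u ++ x ++ [c] = (W ++ a :: List.replicate (m + 1) b) ++ [b] := by
        simpa [hw, List.replicate_succ'] using hu
      simpa using (List.append_inj' hx rfl).2
    have h' : t ++ t' = (List.replicate (n + 2) a ++ [b, a]) ++ List.replicate (n + 2) b := by
      simpa [tauWord] using ht'
    rcases List.append_eq_append_iff.1 h' with ⟨s, h2, h3⟩ | ⟨s, h2, h3⟩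
    · rcases List.append_eq_append_iff.1 h2.symm with ⟨r, h4, h5⟩ | ⟨r, h4, h5⟩
      · have : b ∈ List.replicate (n + 2) a := by
          rw [h4]; exact List.mem_append_left _ (List.mem_of_getLast? hlastt)
        exact hba (List.eq_of_mem_replicate this)
      · subst h4
        rcases r with _ | ⟨c, _ | ⟨d, r⟩⟩
        · simp [List.getLast?_replicate, hab] at hlastt
        · simp at h5
          obtain ⟨rfl, -⟩ := h5
          have hx : (u ++ List.replicate (n + 1) a) ++ [a, b] =
              (W ++ a :: List.replicate m b) ++ [b, b] := by
            simpa [hw, List.replicate_succ', List.append_assoc] using hu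
          have := (List.append_inj' hx rfl).2
          simp [hab] at this
        · simp at h5
          obtain ⟨rfl, rfl, rfl, -⟩ := h5
          simp [hab] at hlastt
    · have hct : t.count a = n + 3 := by
        have hs : s.count a = 0 := by
          have := congrArg (List.count a) h3
          simp [List.count_replicate, hba] at this
          omega
        rw [h2]; simp [hba, hs]
      have hu0 := full u t hu.symm hct
      subst hu0
      have := congrArg List.length ht'
      simp at hu
      subst hu
      simp at this
      omega
  · rintro t h0 h1 ⟨u, hu⟩ ⟨t', ht'⟩
    obtain ⟨t₁, rfl⟩ : ∃ t₁, t = a :: t₁ := by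
      cases t with
      | nil => exact absurd rfl h0
      | cons c t => simp [hw, hW] at hu; exact ⟨t, by rw [hu.1]⟩
    have ht'a : 1 ≤ t'.count a := by
      cases t' with
      | nil => exact absurd ht' h1
      | cons c t' => simp [tauWord, List.replicate_succ] at ht'; simp [ht'.1]
    have hcount := congrArg (List.count a) ht'
    simp [tauWord, List.count_replicate, hba] at hcount
    obtain ⟨r, hr⟩ : ∃ r, W = a :: t₁ ++ r := by
      rw [hw] at hu
      rcases List.append_eq_append_iff.1 hu with ⟨s, h2, h3⟩ | ⟨s, h2, h3⟩
      · exact ⟨s, h2⟩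
      · cases s with
        | nil => exact ⟨[], by simp [h2]⟩
        | cons c s =>
          simp at h3
          have := congrArg (List.count a) h2
          simp [← h3.1, ha] at this
          omega
    have h' : t' ++ a :: t₁ =
        (List.replicate (n + 2) a ++ [b, a]) ++ List.replicate (n + 2) b := by
      simpa [tauWord] using ht'
    rcases List.append_eq_append_iff.1 h' with ⟨s, h2, h3⟩ | ⟨s, h2, h3⟩
    · rcases List.eq_nil_or_concat s with rfl | ⟨s, c, rfl⟩
      · simp [List.replicate_succ, hab] at h3
      · have h2' : (List.replicate (n + 2) a ++ [b]) ++ [a] = (t' ++ s) ++ [c] := by simpa using h2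
        obtain ⟨h4, h5⟩ := List.append_inj' h2' rfl
        simp at h5
        subst h5
        rcases List.eq_nil_or_concat s with rfl | ⟨s, d, rfl⟩
        · simp at h3
          subst h3
          have hrb := congrArg (List.count b) hr
          have hra := congrArg (List.count a) hr
          simp [hab, hba, List.count_replicate, ha] at hrb hra
          have hr0 : r ≠ [] := by rintro rfl; simp at hra
          rw [hr, List.getLast?_append_of_ne_nil _ hr0] at hlast
          have := List.count_pos_iff.2 (List.mem_of_getLast? hlast)
          omega
        · have h4' : List.replicate (n + 2) a ++ [b] = (t' ++ s) ++ [d] := by simpa using h4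
          obtain ⟨-, h6⟩ := List.append_inj' h4' rfl
          simp at h6
          have hrb := congrArg (List.count b) hr
          rw [h3] at hrb
          simp [← h6, hab] at hrb
          omega
    · have : a ∈ List.replicate (n + 2) b := by rw [h3]; simp
      exact hab (List.eq_of_mem_replicate this)

/-- Filling the variables with `b` works as soon as some variable precedes the last `a`. -/
theorem stronglyAvoids_fillVar_of_countP_pos (hab : a ≠ b) (hn : 1 < n)
    {Q₁ Q₂ : List (α ⊕ Unit)} (hhead : Q₁.head? = some (Sum.inl a))
    (h₁ : Q₁.filterMap Sum.getLeft? = List.replicate n a ++ [b])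
    (h₂ : Q₂.filterMap Sum.getLeft? = List.replicate n b)
    (hpos : 0 < Q₁.countP Sum.isRight) (hlt : Q₁.countP Sum.isRight < n) :
    StronglyAvoids (tauWord a b n) (fillVar b (Q₁ ++ Sum.inl a :: Q₂)) := by
  classical
  have hQ₂ : fillVar b Q₂ = List.replicate Q₂.length b := by
    refine List.eq_replicate_iff.2 ⟨List.length_map _, fun c hc => ?_⟩
    rcases mem_fillVar hc with h | h
    · exact h
    · rw [h₂] at h; exact List.eq_of_mem_replicate h
  have hlast : (fillVar b Q₁).getLast? = some b := by
    rcases List.eq_nil_or_concat Q₁ with rfl | ⟨Q, x, rfl⟩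
    · simp at hhead
    · rcases x with c | _
      · have h : Q.filterMap Sum.getLeft? ++ [c] = List.replicate n a ++ [b] := by
          simpa using h₁
        have := (List.append_inj' h rfl).2
        simp at this
        simp [fillVar, this]
      · simp [fillVar]
  have hl₁ := length_eq_filterMap_add_countP Q₁
  have hl₂ := length_eq_filterMap_add_countP Q₂
  have hca := count_fillVar_of_ne hab Q₁
  have hcb := count_fillVar_self (b := b) Q₁
  rw [h₁] at hl₁ hca hcb
  rw [h₂] at hl₂
  simp [List.count_replicate, hab, hab.symm] at hl₁ hl₂ hca hcb
  have hfill : fillVar b (Q₁ ++ Sum.inl a :: Q₂) =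
      fillVar b Q₁ ++ a :: List.replicate Q₂.length b := by
    rw [fillVar_append, ← hQ₂]; rfl
  rw [hfill]
  refine stronglyAvoids_append_cons_replicate hab hn (by omega) ?_ hlast ?_ hca
    (by omega) (by omega)
  · simp [fillVar, hhead]
  · simp only [fillVar, List.length_map]; omega

theorem exists_stronglyAvoids_fillVar (hab : a ≠ b) (hn : 1 < n) {Q : List (α ⊕ Unit)}
    (hhead : Q.head? = some (Sum.inl a)) (hlast : Q.getLast? = some (Sum.inl b))
    (hQ : Q.filterMap Sum.getLeft? = tauWord a b n)
    (hpos : 0 < Q.countP Sum.isRight) (hlt : Q.countP Sum.isRight < n) :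
    ∃ θ, (θ = a ∨ θ = b) ∧ StronglyAvoids (tauWord a b n) (fillVar θ Q) := by
  have hQ' : Q.filterMap Sum.getLeft? =
      (List.replicate n a ++ [b]) ++ (a :: List.replicate n b) := by simpa [tauWord] using hQ
  obtain ⟨R₁, R₂, rfl, h₁, hR⟩ := List.filterMap_eq_append_iff.1 hQ'
  obtain ⟨V, x, Q₂, rfl, hV, hx, h₂⟩ := List.filterMap_eq_cons_iff.1 hR
  obtain rfl : x = Sum.inl a := by rcases x with c | _ <;> simp at hx; rw [hx]
  have hV' : V.filterMap Sum.getLeft? = [] := List.filterMap_eq_nil_iff.2 hV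
  obtain ⟨Q₁, hQ₁⟩ : ∃ Q₁, Q₁ = R₁ ++ V := ⟨_, rfl⟩
  have hQ₁' : Q₁.filterMap Sum.getLeft? = List.replicate n a ++ [b] := by
    rw [hQ₁, List.filterMap_append, hV', h₁, List.append_nil]
  have hne : Q₁ ≠ [] := by rintro rfl; simp at hQ₁'
  rw [← List.append_assoc, ← hQ₁] at hhead hlast hpos hlt ⊢
  rw [List.head?_append_of_ne_nil _ hne] at hhead
  have hcount : (Q₁ ++ Sum.inl a :: Q₂).countP Sum.isRight =
      Q₁.countP Sum.isRight + Q₂.countP Sum.isRight := by simp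
  by_cases h0 : 0 < Q₁.countP Sum.isRight
  · exact ⟨b, Or.inr rfl, stronglyAvoids_fillVar_of_countP_pos hab hn hhead hQ₁' h₂ h0 (by omega)⟩
  · refine ⟨a, Or.inl rfl, StronglyAvoids.of_reverse ?_⟩
    have hQ₁e := eq_map_inl_filterMap (Q := Q₁) (by omega)
    rw [hQ₁'] at hQ₁e
    have hQ₂ne : Q₂ ≠ [] := by rintro rfl; simp at h₂; omega
    have hrev : (fillVar a (Q₁ ++ Sum.inl a :: Q₂)).reverse =
        fillVar a ((Q₂.reverse ++ [Sum.inl a]) ++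
          Sum.inl b :: List.map Sum.inl (List.replicate n a)) := by
      rw [hQ₁e]; simp [fillVar]
    rw [reverse_tauWord, hrev]
    refine stronglyAvoids_fillVar_of_countP_pos hab.symm hn ?_ ?_ ?_ ?_ ?_
    · rw [List.head?_append_of_ne_nil _ (by simpa using hQ₂ne), List.head?_reverse]
      simpa [List.getLast?_append, List.getLast?_cons, hQ₂ne,
        List.getLast?_eq_getLast_of_ne_nil hQ₂ne] using hlast
    · simp [List.filterMap_reverse, h₂]
    · simp [List.filterMap_replicate_of_some]
    · rw [List.countP_append, List.countP_reverse]; omega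
    · simp; omega

theorem toList_polyEval_one (P : FreeMonoid (α ⊕ Unit)) :
    (polyEval P 1).toList = P.toList.filterMap Sum.getLeft? := by
  induction P using FreeMonoid.inductionOn' with
  | one => rfl
  | of_mul x P ih => rcases x with c | _ <;> simp_all [polyEval, List.filterMap_cons]

theorem toList_polyEval_of (P : FreeMonoid (α ⊕ Unit)) (θ : α) :
    (polyEval P (FreeMonoid.of θ)).toList = fillVar θ P.toList := by
  induction P using FreeMonoid.inductionOn' with
  | one => rfl
  | of_mul x P ih => rcases x with c | _ <;> simp_all [polyEval, fillVar]

theorem isFactor_iff_infix {w t : FreeMonoid α} : IsFactor w t ↔ w.toList <:+: t.toList :=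
  ⟨fun ⟨u, v, h⟩ => ⟨u.toList, v.toList, by rw [h]; rfl⟩,
    fun ⟨u, v, h⟩ => ⟨FreeMonoid.ofList u, FreeMonoid.ofList v, h.symm⟩⟩

/-- A polynomial with `s` a factor of its erasure has a factor with erasure `s` that begins and
ends with the first and the last letter of `s`. -/
theorem exists_infix_filterMap_eq {s : List α} {P : List (α ⊕ Unit)} {c d : α} {r : List α}
    (hs : s = c :: r ++ [d]) (h : s <:+: P.filterMap Sum.getLeft?) :
    ∃ Q, Q <:+: P ∧ Q.filterMap Sum.getLeft? = s ∧ Q.head? = some (Sum.inl c) ∧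
      Q.getLast? = some (Sum.inl d) := by
  obtain ⟨u, u', h⟩ := h
  have h' : P.filterMap Sum.getLeft? = u ++ c :: (r ++ d :: u') := by simp [← h, hs]
  obtain ⟨X, R, rfl, -, hR⟩ := List.filterMap_eq_append_iff.1 h'
  obtain ⟨V, x, R, rfl, -, hx, hR⟩ := List.filterMap_eq_cons_iff.1 hR
  obtain ⟨M, R, rfl, hM, hR⟩ := List.filterMap_eq_append_iff.1 hR
  obtain ⟨V', y, R, rfl, hV', hy, -⟩ := List.filterMap_eq_cons_iff.1 hR
  obtain rfl : x = Sum.inl c := by rcases x with c | _ <;> simp at hx; rw [hx]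
  obtain rfl : y = Sum.inl d := by rcases y with c | _ <;> simp at hy; rw [hy]
  refine ⟨Sum.inl c :: (M ++ V') ++ [Sum.inl d], ⟨X ++ V, R, by simp⟩, ?_, by simp, ?_⟩
  · have : V'.filterMap Sum.getLeft? = [] := List.filterMap_eq_nil_iff.2 hV'
    simp [hM, this, hs]
  · rw [List.getLast?_concat]

end Lists

/-- For `τ = aⁿbabⁿ` and a τ-irreducible unary polynomial `P` of degree `k` with
`|τ| ≥ 2k + 4`: if `P(ε)` is τ-reducible, then for some letter `θ ∈ {a, b}`, the word
`P(θ)` has a factor `w` longer than `τ` that is τ-irreducible and does not overlap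
with `τ`. -/
theorem word_exists_strongly_irreducible_factor {α : Type*} (a b : α) (hab : a ≠ b)
    (n : ℕ) (hn : 1 < n)
    (τ : FreeMonoid α)
    (hτ : τ = (FreeMonoid.of a) ^ n * FreeMonoid.of b * FreeMonoid.of a * (FreeMonoid.of b) ^ n)
    (P : FreeMonoid (α ⊕ Unit)) (k : ℕ)
    (hk : ((FreeMonoid.toList P).countP Sum.isRight) = k)
    (hPirr : ¬ IsFactor (FreeMonoid.map Sum.inl τ) P)
    (hklen : 2 * k + 4 ≤ τ.length)
    (hred : IsFactor τ (polyEval P 1)) :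
    ∃ θ : α, (θ = a ∨ θ = b) ∧ ∃ w : FreeMonoid α,
      IsFactor w (polyEval P (FreeMonoid.of θ)) ∧
      τ.length < w.length ∧
      ¬ IsFactor τ w ∧
      ¬ ∃ u t' t : FreeMonoid α, t ≠ 1 ∧ t ≠ τ ∧
        ((w = u * t ∧ τ = t * t') ∨ (τ = t' * t ∧ w = t * u)) := by
  have hτl : τ.toList = tauWord a b n := by
    have hpow (c : α) (m : ℕ) : (FreeMonoid.of c ^ m).toList = List.replicate m c := by
      induction m with
      | zero => rfl
      | succ m ih => simp [pow_succ, ih, List.replicate_succ']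
    simp [hτ, hpow, tauWord]
  have hlen : τ.length = 2 * n + 2 := by
    rw [← length_tauWord (a := a) (b := b), ← hτl]; rfl
  rw [isFactor_iff_infix, hτl, toList_polyEval_one] at hred
  rw [isFactor_iff_infix, FreeMonoid.toList_map, hτl] at hPirr
  obtain ⟨m, rfl⟩ : ∃ m, n = m + 1 := ⟨n - 1, by omega⟩
  obtain ⟨Q, hQP, hQ, hhead, hlast⟩ := exists_infix_filterMap_eq (c := a) (d := b)
    (r := List.replicate m a ++ [b, a] ++ List.replicate m b)
    (by simp [tauWord, List.replicate_succ, ← List.replicate_succ']) hred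
  have hpos : 0 < Q.countP Sum.isRight := by
    by_contra h0
    have := eq_map_inl_filterMap (Q := Q) (by omega)
    rw [hQ] at this
    exact hPirr (this ▸ hQP)
  have hle := hQP.sublist.countP_le (p := Sum.isRight)
  obtain ⟨θ, hθ, h⟩ := exists_stronglyAvoids_fillVar hab hn hhead hlast hQ hpos (by omega)
  rw [← hτl] at h
  refine ⟨θ, hθ, FreeMonoid.ofList (fillVar θ Q), ?_, h.length_lt, ?_, ?_⟩
  · rw [isFactor_iff_infix, toList_polyEval_of]
    obtain ⟨X, Y, hXY⟩ := hQP
    exact ⟨fillVar θ X, fillVar θ Y, by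
      rw [← hXY, fillVar_append, fillVar_append, FreeMonoid.toList_ofList]⟩
  · rw [isFactor_iff_infix]; exact h.not_infix
  · rintro ⟨u, t', t, h0, h1, ⟨h2, h3⟩ | ⟨h2, h3⟩⟩
    · exact h.no_suffix_overlap t.toList h0 h1 ⟨u.toList, h2.symm⟩ ⟨t'.toList, h3.symm⟩
    · exact h.no_prefix_overlap t.toList h0 h1 ⟨u.toList, h3.symm⟩ ⟨t'.toList, h2.symm⟩
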